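/- Fix x ∈ [0,1], σ ≠ 0, a continuous function u₀ : [0,1] → ℝ, and a bounded continuous function b : ℝ → ℝ. For δ > 0 define μ_δ = ∫₀¹ G_δ(x,y) u₀(y) dy + ∫₀^δ ∫₀¹ G_{δ−s}(x,y) b(u₀(y)) dy ds, ν_δ = σ² ∫₀^δ ∫₀¹ G_s(x,y)² dy ds, and the Gaussian density q^δ(z) = (2π ν_δ)^{-1/2} exp(−(z − μ_δ)²/(2ν_δ)). Then for every z ∈ ℝ, lim_{δ→0⁺} δ^{1/2} log q^δ(z) = −(√(2π)/(4σ²)) (1 + sgn(x(1−x))) (z − u₀(x))². -/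

import Mathlib

open MeasureTheory Real Filter

/-- The Neumann heat Green function on `[0,1]`. -/
noncomputable def G (t x y : ℝ) : ℝ :=
  (1 / Real.sqrt (4 * Real.pi * t)) *
    ∑' n : ℤ, (Real.exp (-(x - y - 2 * (n : ℝ)) ^ 2 / (4 * t)) +
      Real.exp (-(x + y - 2 * (n : ℝ)) ^ 2 / (4 * t)))

/-- Mean of the one-step approximation. -/
noncomputable def μδ (x : ℝ) (u₀ b : ℝ → ℝ) (δ : ℝ) : ℝ :=
  (∫ y in (0:ℝ)..1, G δ x y * u₀ y) +
    ∫ s in (0:ℝ)..δ, ∫ y in (0:ℝ)..1, G (δ - s) x y * b (u₀ y)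

/-- Variance of the one-step approximation. -/
noncomputable def νδ (x σ δ : ℝ) : ℝ :=
  σ ^ 2 * ∫ s in (0:ℝ)..δ, ∫ y in (0:ℝ)..1, (G s x y) ^ 2

/-- Gaussian density with mean `μδ` and variance `νδ`. -/
noncomputable def qδ (x σ : ℝ) (u₀ b : ℝ → ℝ) (δ z : ℝ) : ℝ :=
  (1 / Real.sqrt (2 * Real.pi * νδ x σ δ)) *
    Real.exp (-(z - μδ x u₀ b δ) ^ 2 / (2 * νδ x σ δ))

/-- The pair of reflected Gaussian images indexed by `n` in the Neumann heat kernel. -/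
noncomputable def imageTerm (t x y : ℝ) (n : ℤ) : ℝ :=
  Real.exp (-(x - y - 2 * (n : ℝ)) ^ 2 / (4 * t)) +
    Real.exp (-(x + y - 2 * (n : ℝ)) ^ 2 / (4 * t))

/-- The unnormalised Neumann heat kernel. -/
noncomputable def imageSum (t x y : ℝ) : ℝ := ∑' n : ℤ, imageTerm t x y n

lemma imageTerm_nonneg (t x y : ℝ) (n : ℤ) : 0 ≤ imageTerm t x y n := by
  unfold imageTerm; positivity

lemma imageSum_nonneg (t x y : ℝ) : 0 ≤ imageSum t x y :=
  tsum_nonneg (imageTerm_nonneg t x y)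

/-- The normalising factor of the Gaussian mass seen from `x`: doubled at the boundary. -/
noncomputable def boundaryFactor (x : ℝ) : ℝ := if x = 0 ∨ x = 1 then 2 else 1

lemma exp_image_le {t d c m : ℝ} (ht : 0 < t) (ht1 : t ≤ 1) (h0 : c ^ 2 ≤ d ^ 2)
    (h1 : c ^ 2 + (m - 1) ≤ d ^ 2) :
    Real.exp (-d ^ 2 / (4 * t)) ≤ Real.exp (-c ^ 2 / (4 * t)) * Real.exp ((1 - m) / 4) := by
  rw [← Real.exp_add, Real.exp_le_exp, ← sub_nonneg]
  have : -c ^ 2 / (4 * t) + (1 - m) / 4 - -d ^ 2 / (4 * t)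
      = ((d ^ 2 - c ^ 2) - t * (m - 1)) / (4 * t) := by field_simp; ring
  rw [this]
  apply div_nonneg _ (by positivity)
  rcases le_total m 1 with h | h <;> nlinarith

lemma imageTerm_le {t x y : ℝ} (ht : 0 < t) (ht1 : t ≤ 1) (hx : x ∈ Set.Icc (0 : ℝ) 1)
    (hy : y ∈ Set.Icc (0 : ℝ) 1) (n : ℤ) :
    imageTerm t x y n ≤
      Real.exp (-(x - y) ^ 2 / (4 * t)) * (2 * Real.exp ((1 - |(n : ℝ)|) / 4)) := by
  obtain ⟨hx0, hx1⟩ := hx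
  obtain ⟨hy0, hy1⟩ := hy
  have hn : n ≤ -1 ∨ n = 0 ∨ 1 ≤ n := by omega
  have key : ∀ d : ℝ, (x - y) ^ 2 ≤ d ^ 2 ∧ (x - y) ^ 2 + (|(n : ℝ)| - 1) ≤ d ^ 2 →
      Real.exp (-d ^ 2 / (4 * t)) ≤
        Real.exp (-(x - y) ^ 2 / (4 * t)) * Real.exp ((1 - |(n : ℝ)|) / 4) :=
    fun d hd => exp_image_le ht ht1 hd.1 hd.2
  have h1 := key (x - y - 2 * n) (by
    rcases hn with h | h | h
    · have h' : (n : ℝ) ≤ -1 := by exact_mod_cast h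
      rw [abs_of_nonpos (by linarith)]
      constructor <;> nlinarith
    · subst h; norm_num
    · have h' : (1 : ℝ) ≤ n := by exact_mod_cast h
      rw [abs_of_nonneg (by linarith)]
      constructor <;> nlinarith)
  have h2 := key (x + y - 2 * n) (by
    have e : (x + y - 2 * n) ^ 2 = (x - y) ^ 2 + 4 * ((n - x) * (n - y)) := by ring
    rw [e]
    rcases hn with h | h | h
    · have h' : (n : ℝ) ≤ -1 := by exact_mod_cast h
      rw [abs_of_nonpos (by linarith)]
      constructor <;> nlinarith
    · subst h; norm_num; constructor <;> nlinarith [mul_nonneg hx0 hy0]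
    · have h' : (1 : ℝ) ≤ n := by exact_mod_cast h
      rw [abs_of_nonneg (by linarith)]
      have h3 : ((n : ℝ) - 1) * (n - 1) ≤ (n - x) * (n - y) := by
        apply mul_le_mul <;> linarith
      have h4 : 0 ≤ ((n : ℝ) - 1) * (n - 1) := mul_self_nonneg _
      refine ⟨by linarith, ?_⟩
      rcases (show n = 1 ∨ 2 ≤ n by omega) with h5 | h5
      · subst h5; norm_num at *; linarith
      · have h6 : (2 : ℝ) ≤ n := by exact_mod_cast h5
        nlinarith)
  unfold imageTerm
  linarith

lemma summable_exp_abs_int : Summable fun n : ℤ => 2 * Real.exp ((1 - |(n : ℝ)|) / 4) := by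
  have h : Summable fun n : ℕ => 2 * Real.exp ((1 - (n : ℝ)) / 4) := by
    have := (Real.summable_exp_nat_mul_iff (a := -(1 / 4))).2 (by norm_num)
    refine (this.mul_left (2 * Real.exp (1 / 4))).congr fun n => ?_
    rw [mul_assoc, ← Real.exp_add]
    ring_nf
  exact Summable.of_nat_of_neg (by simpa using h) (by simpa using h)

lemma imageSum_le {t x y : ℝ} (ht : 0 < t) (ht1 : t ≤ 1) (hx : x ∈ Set.Icc (0 : ℝ) 1)
    (hy : y ∈ Set.Icc (0 : ℝ) 1) :
    imageSum t x y ≤ Real.exp (-(x - y) ^ 2 / (4 * t)) *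
      ∑' n : ℤ, 2 * Real.exp ((1 - |(n : ℝ)|) / 4) := by
  have hs := summable_exp_abs_int.mul_left (Real.exp (-(x - y) ^ 2 / (4 * t)))
  rw [← tsum_mul_left]
  exact (hs.of_nonneg_of_le (imageTerm_nonneg t x y) (imageTerm_le ht ht1 hx hy)).tsum_le_tsum
    (imageTerm_le ht ht1 hx hy) hs

lemma tendsto_exp_image (c w : ℝ) :
    Tendsto (fun s : ℝ => Real.exp (-(c + Real.sqrt s * w) ^ 2 / (4 * s)))
      (nhdsWithin 0 (Set.Ioi 0)) (nhds (if c = 0 then Real.exp (-w ^ 2 / 4) else 0)) := by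
  split_ifs with hc
  · apply tendsto_const_nhds.congr'
    filter_upwards [self_mem_nhdsWithin] with s hs
    have hs : 0 < s := hs
    rw [hc, zero_add, mul_pow, Real.sq_sqrt hs.le]
    congr 1
    field_simp
  · apply Real.tendsto_exp_atBot.comp
    have h1 : Tendsto (fun s : ℝ => -(c + Real.sqrt s * w) ^ 2 / 4)
        (nhdsWithin 0 (Set.Ioi 0)) (nhds (-c ^ 2 / 4)) := by
      have : Continuous fun s : ℝ => -(c + Real.sqrt s * w) ^ 2 / 4 := by fun_prop
      simpa using (this.tendsto 0).mono_left nhdsWithin_le_nhds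
    have := Tendsto.neg_mul_atTop (by have := sq_pos_of_ne_zero hc; linarith) h1
      (tendsto_inv_nhdsGT_zero (𝕜 := ℝ))
    refine this.congr fun s => ?_
    rw [div_mul_eq_mul_div, ← div_eq_mul_inv, div_div, mul_comm s 4]

lemma tsum_image_limit {x : ℝ} (hx : x ∈ Set.Icc (0 : ℝ) 1) (e : ℝ) :
    ∑' n : ℤ, ((if 2 * (n : ℝ) = 0 then e else 0) + (if 2 * x - 2 * (n : ℝ) = 0 then e else 0)) =
      boundaryFactor x * e := by
  have a1 : HasSum (fun n : ℤ => if 2 * (n : ℝ) = 0 then e else 0) e := by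
    simpa using hasSum_ite_eq (0 : ℤ) e
  have a2 : HasSum (fun n : ℤ => if 2 * x - 2 * (n : ℝ) = 0 then e else 0)
      (if x = 0 ∨ x = 1 then e else 0) := by
    split_ifs with h
    · rcases h with rfl | rfl
      · simpa using hasSum_ite_eq (0 : ℤ) e
      · convert hasSum_ite_eq (1 : ℤ) e using 2 with n
        have : (2 * 1 - 2 * (n : ℝ) = 0) ↔ n = 1 := by
          rw [← Int.cast_inj (α := ℝ)]; push_cast; constructor <;> intro h <;> linarith
        simp only [this]
    · convert (hasSum_zero : HasSum (fun _ : ℤ => (0 : ℝ)) 0) using 2 with n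
      rw [if_neg]
      intro hn
      have hxn : x = n := by linarith
      obtain ⟨h0, h1⟩ := hx
      rw [hxn] at h0 h1 h
      have h0 : 0 ≤ n := by exact_mod_cast h0
      have h1 : n ≤ 1 := by exact_mod_cast h1
      have : n = 0 ∨ n = 1 := by omega
      exact h (by exact_mod_cast this)
  rw [(a1.add a2).tsum_eq, boundaryFactor]
  split_ifs <;> ring

lemma tendsto_imageSum {x : ℝ} (hx : x ∈ Set.Icc (0 : ℝ) 1) (w : ℝ)
    (hw : ∀ᶠ s in nhdsWithin (0 : ℝ) (Set.Ioi 0), x + Real.sqrt s * w ∈ Set.Icc (0 : ℝ) 1) :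
    Tendsto (fun s : ℝ => imageSum s x (x + Real.sqrt s * w))
      (nhdsWithin 0 (Set.Ioi 0)) (nhds (boundaryFactor x * Real.exp (-w ^ 2 / 4))) := by
  rw [← tsum_image_limit hx]
  refine tendsto_tsum_of_dominated_convergence summable_exp_abs_int (fun n => ?_) ?_
  · refine ((tendsto_exp_image (2 * n) w).add (tendsto_exp_image (2 * x - 2 * n) w)).congr
      fun s => ?_
    unfold imageTerm
    congr 3 <;> ring
  · filter_upwards [hw, Ioc_mem_nhdsGT (zero_lt_one (α := ℝ))] with s hs hs1 n
    rw [Real.norm_of_nonneg (imageTerm_nonneg _ _ _ _)]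
    refine (imageTerm_le hs1.1 hs1.2 hx hs n).trans (mul_le_of_le_one_left (by positivity) ?_)
    rw [Real.exp_le_one_iff]
    exact div_nonpos_of_nonpos_of_nonneg (by simpa using sq_nonneg _) (by linarith [hs1.1])

lemma measurable_imageSum (x : ℝ) : Measurable fun p : ℝ × ℝ => imageSum p.1 x p.2 := by
  refine Measurable.tsum fun n => ?_
  unfold imageTerm
  fun_prop

/-- The set of directions pointing from `x` into the unit interval. -/
def inwardSet (x : ℝ) : Set ℝ :=
  if x = 0 then Set.Ioi 0 else if x = 1 then Set.Iic 0 else Set.univ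

lemma measurableSet_inwardSet (x : ℝ) : MeasurableSet (inwardSet x) := by
  unfold inwardSet
  split_ifs <;> simp

lemma integral_gaussian_inwardSet (x a : ℝ) :
    ∫ w in inwardSet x, Real.exp (-a * w ^ 2) = Real.sqrt (Real.pi / a) / boundaryFactor x := by
  unfold inwardSet boundaryFactor
  by_cases h0 : x = 0
  · simp only [h0, if_true, true_or, integral_gaussian_Ioi]
  by_cases h1 : x = 1
  · have := integral_comp_neg_Iic (0 : ℝ) fun w => Real.exp (-a * w ^ 2)
    simp only [neg_zero, neg_sq, integral_gaussian_Ioi] at this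
    simp only [h1, one_ne_zero, if_true, if_false, or_true, this]
  · simp [h0, h1, ← integral_gaussian]

lemma eventually_mem_Ioc_iff {x : ℝ} (hx : x ∈ Set.Icc (0 : ℝ) 1) (w : ℝ) :
    ∀ᶠ s in nhdsWithin (0 : ℝ) (Set.Ioi 0),
      (x + Real.sqrt s * w ∈ Set.Ioc (0 : ℝ) 1 ↔ w ∈ inwardSet x) := by
  have hc : Tendsto (fun s : ℝ => x + Real.sqrt s * w) (nhdsWithin 0 (Set.Ioi 0)) (nhds x) := by
    have : Continuous fun s : ℝ => x + Real.sqrt s * w := by fun_prop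
    simpa using (this.tendsto 0).mono_left nhdsWithin_le_nhds
  unfold inwardSet
  split_ifs with h0 h1
  · subst h0
    filter_upwards [self_mem_nhdsWithin, hc.eventually_lt_const zero_lt_one] with s hs h
    have hs : 0 < Real.sqrt s := Real.sqrt_pos.2 hs
    simp only [zero_add] at h ⊢
    exact ⟨fun h' => pos_of_mul_pos_right h'.1 hs.le, fun h' => ⟨mul_pos hs h', h.le⟩⟩
  · subst h1
    filter_upwards [self_mem_nhdsWithin, hc.eventually_const_lt zero_lt_one] with s hs h
    have hs : 0 < Real.sqrt s := Real.sqrt_pos.2 hs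
    refine ⟨fun h' => ?_, fun h' => ⟨h, ?_⟩⟩
    · have := h'.2
      simp only [Set.mem_Iic]
      by_contra! hw
      have := mul_pos hs hw
      linarith
    · have := mul_nonpos_of_nonneg_of_nonpos hs.le h'
      linarith
  · have hx0 : 0 < x := lt_of_le_of_ne hx.1 (Ne.symm h0)
    have hx1 : x < 1 := lt_of_le_of_ne hx.2 h1
    filter_upwards [hc.eventually_const_lt hx0, hc.eventually_lt_const hx1] with s h h'
    simp [h, h'.le]

/-- Small-time localisation of powers of the unnormalised Neumann heat kernel. -/
lemma tendsto_integral_imageSum_pow {x : ℝ} (hx : x ∈ Set.Icc (0 : ℝ) 1) {φ : ℝ → ℝ}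
    (hφ : Continuous φ) {p : ℕ} (hp : p ≠ 0) :
    Tendsto (fun s : ℝ => (∫ y in (0 : ℝ)..1, imageSum s x y ^ p * φ y) / Real.sqrt s)
      (nhdsWithin 0 (Set.Ioi 0))
      (nhds (φ x * (boundaryFactor x ^ p * (Real.sqrt (Real.pi / (p / 4)) / boundaryFactor x)))) := by
  have hp' : (0 : ℝ) < p := by positivity
  have hexp : ∀ w : ℝ, Real.exp (-w ^ 2 / 4) ^ p = Real.exp (-(p / 4 : ℝ) * w ^ 2) := fun w => by
    rw [← Real.exp_nat_mul]; congr 1; ring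
  set C := ∑' n : ℤ, 2 * Real.exp ((1 - |(n : ℝ)|) / 4) with hC
  have hC0 : 0 ≤ C := tsum_nonneg fun n => by positivity
  obtain ⟨B, hB⟩ := (isCompact_Icc (a := (0 : ℝ)) (b := 1)).exists_bound_of_continuousOn
    hφ.continuousOn
  have hB0 : 0 ≤ B := (norm_nonneg _).trans (hB x hx)
  let g : ℝ → ℝ → ℝ := fun s => (Set.Ioc (0 : ℝ) 1).indicator fun y => imageSum s x y ^ p * φ y
  have hlim : ∫ w, (inwardSet x).indicator
      (fun w => (boundaryFactor x * Real.exp (-w ^ 2 / 4)) ^ p * φ x) w =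
      φ x * (boundaryFactor x ^ p * (Real.sqrt (Real.pi / (p / 4)) / boundaryFactor x)) := by
    rw [integral_indicator (measurableSet_inwardSet x), ← integral_gaussian_inwardSet,
      ← integral_const_mul, ← integral_const_mul]
    congr 1 with w
    rw [mul_pow, hexp]
    ring
  rw [← hlim]
  have hscale : ∀ s : ℝ, 0 < s → ∫ w, g s (x + Real.sqrt s * w) =
      (∫ y in (0 : ℝ)..1, imageSum s x y ^ p * φ y) / Real.sqrt s := fun s hs => by
    rw [Measure.integral_comp_mul_left (fun v => g s (x + v)) (Real.sqrt s),
      integral_add_left_eq_self (g s) x, integral_indicator measurableSet_Ioc,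
      intervalIntegral.integral_of_le zero_le_one, abs_of_nonneg (by positivity), smul_eq_mul,
      inv_mul_eq_div]
  refine Tendsto.congr' (f₁ := fun s => ∫ w, g s (x + Real.sqrt s * w)) ?_ ?_
  · filter_upwards [self_mem_nhdsWithin] with s hs using hscale s hs
  refine tendsto_integral_filter_of_dominated_convergence
    (fun w => C ^ p * B * Real.exp (-(p / 4 : ℝ) * w ^ 2)) ?_ ?_ ?_ ?_
  · refine Eventually.of_forall fun s => Measurable.aestronglyMeasurable ?_
    have : Measurable (g s) := by
      refine Measurable.indicator ?_ measurableSet_Ioc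
      exact (((measurable_imageSum x).comp measurable_prodMk_left).pow_const p).mul hφ.measurable
    exact this.comp (by fun_prop)
  · filter_upwards [Ioc_mem_nhdsGT (zero_lt_one (α := ℝ))] with s hs
    refine Eventually.of_forall fun w => ?_
    by_cases hm : x + Real.sqrt s * w ∈ Set.Ioc (0 : ℝ) 1
    · have hm' := Set.Ioc_subset_Icc_self hm
      simp only [g, Set.indicator_of_mem hm]
      have h1 := imageSum_le hs.1 hs.2 hx hm'
      have h2 : -(x - (x + Real.sqrt s * w)) ^ 2 / (4 * s) = -w ^ 2 / 4 := by
        have hsq : (x - (x + Real.sqrt s * w)) ^ 2 = s * w ^ 2 := by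
          rw [← Real.sq_sqrt hs.1.le]; simp only [Real.sqrt_sq (Real.sqrt_nonneg s)]; ring
        have := hs.1.ne'
        rw [hsq]
        field_simp
      rw [h2] at h1
      have h3 := pow_le_pow_left₀ (imageSum_nonneg _ _ _) h1 p
      rw [mul_pow, hexp] at h3
      rw [norm_mul, norm_pow, Real.norm_of_nonneg (imageSum_nonneg _ _ _)]
      calc _ ≤ _ * B := mul_le_mul h3 (hB _ hm') (norm_nonneg _) (by positivity)
        _ = _ := by ring
    · simp only [g, Set.indicator_of_notMem hm, norm_zero]
      positivity
  · exact (integrable_exp_neg_mul_sq (by positivity)).const_mul _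
  · refine Eventually.of_forall fun w => ?_
    have hc : Tendsto (fun s : ℝ => x + Real.sqrt s * w) (nhdsWithin 0 (Set.Ioi 0)) (nhds x) := by
      have : Continuous fun s : ℝ => x + Real.sqrt s * w := by fun_prop
      simpa using (this.tendsto 0).mono_left nhdsWithin_le_nhds
    by_cases hw : w ∈ inwardSet x
    · rw [Set.indicator_of_mem hw]
      have hev : ∀ᶠ s in nhdsWithin (0 : ℝ) (Set.Ioi 0),
          x + Real.sqrt s * w ∈ Set.Ioc (0 : ℝ) 1 :=
        (eventually_mem_Ioc_iff hx w).mono fun s hs => hs.2 hw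
      refine Tendsto.congr' ?_ (((tendsto_imageSum hx w
        (hev.mono fun s hs => Set.Ioc_subset_Icc_self hs)).pow p).mul
          ((hφ.tendsto x).comp hc))
      filter_upwards [hev] with s hs
      simp only [g, Set.indicator_of_mem hs, Function.comp]
    · rw [Set.indicator_of_notMem hw]
      refine tendsto_const_nhds.congr' ?_
      filter_upwards [eventually_mem_Ioc_iff hx w] with s hs
      simp only [g, Set.indicator_of_notMem (mt hs.1 hw)]

lemma boundaryFactor_pos (x : ℝ) : 0 < boundaryFactor x := by
  unfold boundaryFactor; split_ifs <;> norm_num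

lemma G_eq (t x y : ℝ) : G t x y = (1 / Real.sqrt (4 * Real.pi * t)) * imageSum t x y := rfl

lemma sqrt_four_mul_pi_mul (t : ℝ) :
    Real.sqrt (4 * Real.pi * t) = Real.sqrt (4 * Real.pi) * Real.sqrt t :=
  Real.sqrt_mul (by positivity) t

/-- The Neumann heat semigroup converges pointwise to the identity on continuous functions. -/
lemma tendsto_integral_G {x : ℝ} (hx : x ∈ Set.Icc (0 : ℝ) 1) {f : ℝ → ℝ}
    (hf : ContinuousOn f (Set.Icc 0 1)) :
    Tendsto (fun t : ℝ => ∫ y in (0 : ℝ)..1, G t x y * f y)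
      (nhdsWithin 0 (Set.Ioi 0)) (nhds (f x)) := by
  have hφ : Continuous fun y => f (Set.projIcc (0 : ℝ) 1 zero_le_one y) :=
    hf.comp_continuous (by fun_prop) fun y => (Set.projIcc (0 : ℝ) 1 zero_le_one y).2
  have h := (tendsto_integral_imageSum_pow hx hφ one_ne_zero).const_mul
    (1 / Real.sqrt (4 * Real.pi))
  have hκ := (boundaryFactor_pos x).ne'
  have hpi : Real.sqrt (4 * Real.pi) ≠ 0 := by positivity
  have hlim : 1 / Real.sqrt (4 * Real.pi) * (f (Set.projIcc (0 : ℝ) 1 zero_le_one x) *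
      (boundaryFactor x ^ 1 * (Real.sqrt (Real.pi / ((1 : ℕ) / 4)) / boundaryFactor x))) = f x := by
    rw [Set.projIcc_of_mem zero_le_one hx,
      show Real.pi / ((1 : ℕ) / 4) = 4 * Real.pi by push_cast; ring]
    field_simp
  rw [hlim] at h
  refine h.congr' ?_
  filter_upwards with t
  rw [mul_div_assoc', ← intervalIntegral.integral_const_mul, ← intervalIntegral.integral_div]
  refine intervalIntegral.integral_congr fun y hy => ?_
  rw [Set.uIcc_of_le zero_le_one] at hy
  simp only [Set.projIcc_of_mem zero_le_one hy, G_eq, sqrt_four_mul_pi_mul, pow_one]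
  ring

lemma tendsto_sqrt_mul_integral_G_sq {x : ℝ} (hx : x ∈ Set.Icc (0 : ℝ) 1) :
    Tendsto (fun t : ℝ => Real.sqrt t * ∫ y in (0 : ℝ)..1, G t x y ^ 2)
      (nhdsWithin 0 (Set.Ioi 0))
      (nhds (boundaryFactor x * Real.sqrt (2 * Real.pi) / (4 * Real.pi))) := by
  have h := (tendsto_integral_imageSum_pow hx (continuous_const (y := (1 : ℝ)))
    two_ne_zero).const_mul (1 / (4 * Real.pi))
  have hκ := (boundaryFactor_pos x).ne'
  have hlim : 1 / (4 * Real.pi) * (1 *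
      (boundaryFactor x ^ 2 * (Real.sqrt (Real.pi / ((2 : ℕ) / 4)) / boundaryFactor x))) =
      boundaryFactor x * Real.sqrt (2 * Real.pi) / (4 * Real.pi) := by
    rw [show Real.pi / ((2 : ℕ) / 4) = 2 * Real.pi by push_cast; ring]
    field_simp
  rw [hlim] at h
  refine h.congr' ?_
  filter_upwards [self_mem_nhdsWithin] with t ht
  have ht : 0 < t := ht
  rw [mul_div_assoc', ← intervalIntegral.integral_const_mul, ← intervalIntegral.integral_div,
    ← intervalIntegral.integral_const_mul]
  congr 1 with y
  have hs : 0 < Real.sqrt t := Real.sqrt_pos.2 ht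
  have h4 : Real.sqrt (4 * Real.pi) ^ 2 = 4 * Real.pi := Real.sq_sqrt (by positivity)
  rw [G_eq, sqrt_four_mul_pi_mul, mul_pow, div_pow, mul_pow, h4]
  field_simp

/-- If `√s f(s) → L` as `s → 0⁺`, then `(∫₀^δ f) / √δ → 2 L`. -/
lemma tendsto_integral_div_sqrt {f : ℝ → ℝ} (hf : Measurable f) {L : ℝ}
    (h : Tendsto (fun s => Real.sqrt s * f s) (nhdsWithin 0 (Set.Ioi 0)) (nhds L)) :
    Tendsto (fun δ : ℝ => (∫ s in (0 : ℝ)..δ, f s) / Real.sqrt δ)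
      (nhdsWithin 0 (Set.Ioi 0)) (nhds (2 * L)) := by
  have hint : IntervalIntegrable (fun r : ℝ => r ^ (-(1 / 2) : ℝ)) volume 0 1 :=
    intervalIntegral.intervalIntegrable_rpow' (by norm_num)
  have hlim : ∫ r in (0 : ℝ)..1, L * r ^ (-(1 / 2) : ℝ) = 2 * L := by
    rw [intervalIntegral.integral_const_mul, integral_rpow (by norm_num)]
    norm_num
    ring
  have hpow : ∀ r : ℝ, 0 < r → r ^ (-(1 / 2) : ℝ) = (Real.sqrt r)⁻¹ := fun r hr => by
    rw [Real.rpow_neg hr.le, Real.sqrt_eq_rpow]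
  have hfact : ∀ δ r : ℝ, 0 < δ → 0 < r → Real.sqrt δ * f (δ * r) =
      (Real.sqrt (δ * r) * f (δ * r)) * r ^ (-(1 / 2) : ℝ) := fun δ r hδ hr => by
    have := (Real.sqrt_pos.2 hr).ne'
    rw [hpow r hr, Real.sqrt_mul hδ.le]
    field_simp
  have hscale : ∀ δ : ℝ, 0 < δ → ∫ r in (0 : ℝ)..1, Real.sqrt δ * f (δ * r) =
      (∫ s in (0 : ℝ)..δ, f s) / Real.sqrt δ := fun δ hδ => by
    rw [intervalIntegral.integral_const_mul, intervalIntegral.integral_comp_mul_left f hδ.ne',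
      mul_zero, mul_one, smul_eq_mul]
    have h1 : 0 < Real.sqrt δ := Real.sqrt_pos.2 hδ
    have h2 : Real.sqrt δ ^ 2 = δ := Real.sq_sqrt hδ.le
    field_simp
    rw [h2]
  rw [← hlim]
  refine Tendsto.congr' (f₁ := fun δ => ∫ r in (0 : ℝ)..1, Real.sqrt δ * f (δ * r)) ?_ ?_
  · filter_upwards [self_mem_nhdsWithin] with δ hδ using hscale δ hδ
  have hbd : ∀ᶠ s in nhdsWithin (0 : ℝ) (Set.Ioi 0), |Real.sqrt s * f s| < |L| + 1 :=
    h.abs.eventually_lt_const (by linarith)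
  obtain ⟨ε, hε, hεb⟩ := mem_nhdsGT_iff_exists_Ioo_subset.1 hbd
  refine intervalIntegral.tendsto_integral_filter_of_dominated_convergence
    (fun r => (|L| + 1) * r ^ (-(1 / 2) : ℝ)) ?_ ?_ (hint.const_mul _) ?_
  · exact Eventually.of_forall fun δ =>
      ((hf.comp (measurable_const_mul δ)).const_mul _).aestronglyMeasurable
  · filter_upwards [Ioo_mem_nhdsGT hε] with δ hδ
    refine Eventually.of_forall fun r hr => ?_
    rw [Set.uIoc_of_le zero_le_one] at hr
    rw [hfact δ r hδ.1 hr.1, norm_mul, Real.norm_of_nonneg (Real.rpow_nonneg hr.1.le _)]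
    refine mul_le_mul_of_nonneg_right (le_of_lt (hεb ⟨mul_pos hδ.1 hr.1, ?_⟩))
      (Real.rpow_nonneg hr.1.le _)
    nlinarith [hδ.1, hδ.2, hr.2]
  · refine Eventually.of_forall fun r hr => ?_
    rw [Set.uIoc_of_le zero_le_one] at hr
    have hc : Tendsto (fun δ : ℝ => δ * r) (nhdsWithin 0 (Set.Ioi 0))
        (nhdsWithin 0 (Set.Ioi 0)) := by
      refine tendsto_nhdsWithin_iff.2 ⟨?_, ?_⟩
      · have : Continuous fun δ : ℝ => δ * r := by fun_prop
        simpa using (this.tendsto 0).mono_left nhdsWithin_le_nhds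
      · filter_upwards [self_mem_nhdsWithin] with δ hδ using mul_pos hδ hr.1
    refine ((h.comp hc).mul_const _).congr' ?_
    filter_upwards [self_mem_nhdsWithin] with δ hδ using (hfact δ r hδ hr.1).symm

lemma measurable_integral_G_sq (x : ℝ) :
    Measurable fun s : ℝ => ∫ y in (0 : ℝ)..1, G s x y ^ 2 := by
  simp only [intervalIntegral.integral_of_le (zero_le_one (α := ℝ))]
  have h : Measurable fun p : ℝ × ℝ => G p.1 x p.2 ^ 2 := by
    simp only [G_eq]
    exact ((by fun_prop : Measurable fun p : ℝ × ℝ => 1 / Real.sqrt (4 * Real.pi * p.1)).mul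
      (measurable_imageSum x)).pow_const 2
  exact h.stronglyMeasurable.integral_prod_right.measurable

lemma tendsto_variance_div_sqrt {x : ℝ} (hx : x ∈ Set.Icc (0 : ℝ) 1) (σ : ℝ) :
    Tendsto (fun δ : ℝ => νδ x σ δ / Real.sqrt δ) (nhdsWithin 0 (Set.Ioi 0))
      (nhds (σ ^ 2 * (2 * (boundaryFactor x * Real.sqrt (2 * Real.pi) / (4 * Real.pi))))) := by
  refine ((tendsto_integral_div_sqrt (measurable_integral_G_sq x)
    (tendsto_sqrt_mul_integral_G_sq hx)).const_mul (σ ^ 2)).congr fun δ => ?_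
  rw [νδ, mul_div_assoc]

lemma tendsto_mean {x : ℝ} (hx : x ∈ Set.Icc (0 : ℝ) 1) {u₀ b : ℝ → ℝ}
    (hu₀ : ContinuousOn u₀ (Set.Icc 0 1)) (hb : Continuous b) :
    Tendsto (μδ x u₀ b) (nhdsWithin 0 (Set.Ioi 0)) (nhds (u₀ x)) := by
  rw [← add_zero (u₀ x)]
  refine (tendsto_integral_G hx hu₀).add ?_
  have h := tendsto_integral_G hx (hb.comp_continuousOn hu₀)
  have hbd := h.abs.eventually_lt_const (lt_add_one _)
  obtain ⟨ε, hε, hεb⟩ := mem_nhdsGT_iff_exists_Ioo_subset.1 hbd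
  have hlim : Tendsto (fun δ : ℝ => (|(b ∘ u₀) x| + 1) * |δ - 0|)
      (nhdsWithin 0 (Set.Ioi 0)) (nhds 0) := by
    have : Continuous fun δ : ℝ => (|(b ∘ u₀) x| + 1) * |δ - 0| := by fun_prop
    simpa using (this.tendsto 0).mono_left nhdsWithin_le_nhds
  refine squeeze_zero_norm' ?_ hlim
  filter_upwards [Ioo_mem_nhdsGT hε] with δ hδ
  rw [intervalIntegral.integral_comp_sub_left
    (fun s => ∫ y in (0 : ℝ)..1, G s x y * b (u₀ y)) δ, sub_self, sub_zero]
  refine (intervalIntegral.norm_integral_le_of_norm_le_const fun s hs => ?_).trans_eq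
    (by rw [sub_zero])
  rw [Set.uIoc_of_le hδ.1.le] at hs
  exact (hεb ⟨hs.1, hs.2.trans_lt hδ.2⟩).le

lemma boundaryFactor_eq_sign {x : ℝ} (hx : x ∈ Set.Icc (0 : ℝ) 1) :
    1 + Real.sign (x * (1 - x)) = 2 / boundaryFactor x := by
  unfold boundaryFactor
  split_ifs with h
  · rcases h with rfl | rfl <;> norm_num
  · push Not at h
    have h0 : 0 < x := lt_of_le_of_ne hx.1 (Ne.symm h.1)
    have h1 : x < 1 := lt_of_le_of_ne hx.2 h.2
    rw [Real.sign_of_pos (mul_pos h0 (by linarith))]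
    norm_num

/-- Logarithmic small-time asymptotics of the Gaussian density of the one-step
approximation: `lim_{δ→0⁺} δ^{1/2} log q^δ(z)
  = −(√(2π)/(4σ²)) (1 + sgn(x(1−x))) (z − u₀(x))²`. -/
theorem density_log_asymptotics (x : ℝ) (hx : x ∈ Set.Icc (0:ℝ) 1) (σ : ℝ) (hσ : σ ≠ 0)
    (u₀ : ℝ → ℝ) (hu₀ : ContinuousOn u₀ (Set.Icc 0 1))
    (b : ℝ → ℝ) (hb : Continuous b) (hbbdd : ∃ M : ℝ, ∀ r : ℝ, |b r| ≤ M) (z : ℝ) :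
    Tendsto (fun δ : ℝ => Real.sqrt δ * Real.log (qδ x σ u₀ b δ z))
      (nhdsWithin 0 (Set.Ioi 0))
      (nhds (-(Real.sqrt (2 * Real.pi) / (4 * σ ^ 2)) *
        (1 + Real.sign (x * (1 - x))) * (z - u₀ x) ^ 2)) := by
  have hν := tendsto_variance_div_sqrt hx σ
  have hm := tendsto_mean hx hu₀ hb
  have hκ := boundaryFactor_pos x
  set c := σ ^ 2 * (2 * (boundaryFactor x * Real.sqrt (2 * Real.pi) / (4 * Real.pi))) with hc
  have hc0 : 0 < c := by positivity
  have hsqrt : Tendsto Real.sqrt (nhdsWithin 0 (Set.Ioi 0)) (nhds 0) := by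
    simpa using (Real.continuous_sqrt.tendsto 0).mono_left nhdsWithin_le_nhds
  have hlog : Tendsto (fun δ : ℝ => Real.sqrt δ * Real.log (Real.sqrt δ))
      (nhdsWithin 0 (Set.Ioi 0)) (nhds 0) := by
    have := Real.continuous_mul_log.tendsto 0
    simp only [zero_mul] at this
    exact this.comp hsqrt
  have hlog' := (Real.continuousAt_log hc0.ne').tendsto.comp hν
  have hmain := (((hsqrt.mul_const (Real.log (2 * Real.pi))).add
    (hsqrt.mul hlog')).add hlog).const_mul (-(1 / 2) : ℝ)
  have hexp := ((tendsto_const_nhds (x := z)).sub hm |>.pow 2).neg.div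
    (hν.const_mul 2) (by positivity)
  have hall := hmain.add hexp
  have hval : -(1 / 2) * (0 * Real.log (2 * Real.pi) + 0 * Real.log c + 0) +
      -(z - u₀ x) ^ 2 / (2 * c) = -(Real.sqrt (2 * Real.pi) / (4 * σ ^ 2)) *
        (1 + Real.sign (x * (1 - x))) * (z - u₀ x) ^ 2 := by
    have h2 : Real.sqrt (2 * Real.pi) ^ 2 = 2 * Real.pi := Real.sq_sqrt (by positivity)
    have h3 : 0 < Real.sqrt (2 * Real.pi) := by positivity
    rw [boundaryFactor_eq_sign hx, hc]
    field_simp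
    rw [h2]
    ring
  rw [hval] at hall
  refine hall.congr' ?_
  filter_upwards [self_mem_nhdsWithin, hν.eventually_const_lt hc0] with δ hδ hpos
  have hs : 0 < Real.sqrt δ := Real.sqrt_pos.2 hδ
  have hνpos : 0 < νδ x σ δ := (div_pos_iff_of_pos_right hs).1 hpos
  have hdec : Real.log (νδ x σ δ) = Real.log (νδ x σ δ / Real.sqrt δ) + Real.log (Real.sqrt δ) := by
    rw [← Real.log_mul hpos.ne' hs.ne', div_mul_cancel₀ _ hs.ne']
  have hq : Real.log (qδ x σ u₀ b δ z) =
      -((Real.log (2 * Real.pi) + Real.log (νδ x σ δ)) / 2) +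
        -(z - μδ x u₀ b δ) ^ 2 / (2 * νδ x σ δ) := by
    rw [qδ, Real.log_mul (by positivity) (Real.exp_ne_zero _), Real.log_exp,
      one_div (Real.sqrt _), Real.log_inv, Real.log_sqrt (by positivity),
      Real.log_mul (by positivity) hνpos.ne']
  rw [hq, hdec]
  simp only [Function.comp, Pi.div_apply]
  field_simp
  ring
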